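/- Let Y be a random variable on ℕ₀ = {0,1,2,...} with P[Y = n] = p_n > 0, all moments finite, satisfying: (11) ∑_{n ≥ n0} (-ln p_n)/(n² ln n) = ∞ for some n0 ≥ 2, and (12) n ↦ (-ln(p_n/2))/ln n is monotone increasing to infinity for n ≥ n0. Then Y satisfies the Stieltjes Carleman condition ∑_{k≥1} (E[Y^k])^{-1/(2k)} = ∞ and is moment-determinate on [0, ∞). -/

import Mathlib

open Filter Set MeasureTheory

/-- One step of Bang's argument. -/
lemma bang_step (F : ℕ → ℝ → ℂ) (M R : ℕ → ℝ) (hM : ∀ j, 0 < M j) (hR : ∀ j, 0 < R j)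
    (hRm : Monotone R) (hMR : ∀ j, M (j + 1) ≤ R (j + 1) * M j)
    (hder : ∀ j t, HasDerivAt (F j) (F (j + 1) t) t) (hb : ∀ j t, ‖F j t‖ ≤ M j)
    (N : ℕ) (b : ℝ) (hbN : Real.exp (-(N : ℝ)) ≤ b) (x : ℝ)
    (hx : ∀ j, ‖F j x‖ ≤ b * (Real.exp j * M j)) (y : ℝ) (hy : x ≤ y) (j : ℕ) :
    ‖F j y‖ ≤ b * Real.exp (Real.exp 1 * R N * (y - x)) * (Real.exp j * M j) := by
  have hb0 : 0 < b := lt_of_lt_of_le (Real.exp_pos _) hbN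
  have hc : 0 ≤ Real.exp 1 * R N := mul_nonneg (Real.exp_pos _).le (hR N).le
  have high : ∀ j, N ≤ j → ∀ y, x ≤ y →
      ‖F j y‖ ≤ b * Real.exp (Real.exp 1 * R N * (y - x)) * (Real.exp j * M j) := by
    intro j hj y hy
    have h1 : 1 ≤ Real.exp (Real.exp 1 * R N * (y - x)) :=
      Real.one_le_exp (mul_nonneg hc (by linarith))
    have h2 : 1 ≤ b * Real.exp j := by
      calc (1 : ℝ) = Real.exp (-(N : ℝ)) * Real.exp N := by rw [← Real.exp_add]; simp
        _ ≤ b * Real.exp j := by gcongr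
    have h3 : 1 ≤ (b * Real.exp j) * Real.exp (Real.exp 1 * R N * (y - x)) :=
      one_le_mul_of_one_le_of_one_le h2 h1
    calc ‖F j y‖ ≤ M j := hb j y
      _ ≤ ((b * Real.exp j) * Real.exp (Real.exp 1 * R N * (y - x))) * M j :=
          le_mul_of_one_le_left (hM j).le h3
      _ = _ := by ring
  have low : ∀ d j, j + d = N → ∀ y, x ≤ y →
      ‖F j y‖ ≤ b * Real.exp (Real.exp 1 * R N * (y - x)) * (Real.exp j * M j) := by
    intro d
    induction d with
    | zero => intro j hj; exact high j (by omega)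
    | succ d ih =>
      intro j hj y hy
      have ih' := ih (j + 1) (by omega)
      have key := image_norm_le_of_norm_deriv_right_le_deriv_boundary (f := F j)
        (f' := F (j + 1)) (a := x) (b := y)
        (B := fun y => b * Real.exp (Real.exp 1 * R N * (y - x)) * (Real.exp j * M j))
        (B' := fun y => b * (Real.exp (Real.exp 1 * R N * (y - x)) * (Real.exp 1 * R N))
            * (Real.exp j * M j))
        (fun z _ => (hder j z).continuousAt.continuousWithinAt)
        (fun z _ => (hder j z).hasDerivWithinAt)
        (by simpa using hx j)
        (by
          intro z
          have h1 : HasDerivAt (fun y : ℝ => Real.exp 1 * R N * (y - x)) (Real.exp 1 * R N) z := by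
            simpa using ((hasDerivAt_id z).sub_const x).const_mul (Real.exp 1 * R N)
          exact (h1.exp.const_mul b).mul_const _)
        (by
          intro z hz
          refine (ih' z hz.1).trans ?_
          have h2 : M (j + 1) ≤ R N * M j :=
            (hMR j).trans (mul_le_mul_of_nonneg_right (hRm (by omega)) (hM j).le)
          have h3 : Real.exp ((j + 1 : ℕ) : ℝ) = Real.exp j * Real.exp 1 := by
            push_cast; rw [Real.exp_add]
          rw [h3]
          calc _ ≤ b * Real.exp (Real.exp 1 * R N * (z - x))
                * (Real.exp j * Real.exp 1 * (R N * M j)) := by gcongr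
            _ = _ := by ring)
      exact key (right_mem_Icc.2 hy)
  rcases le_total N j with h | h
  · exact high j h y hy
  · exact low (N - j) j (by omega) y hy

lemma bang (F : ℕ → ℝ → ℂ) (M R : ℕ → ℝ) (hM : ∀ j, 0 < M j) (hR : ∀ j, 0 < R j)
    (hRm : Monotone R) (hMR : ∀ j, M (j + 1) ≤ R (j + 1) * M j)
    (hder : ∀ j t, HasDerivAt (F j) (F (j + 1) t) t) (hb : ∀ j t, ‖F j t‖ ≤ M j)
    (h0 : ∀ j, F j 0 = 0) (hdiv : ¬ Summable (fun k => 1 / R k)) (t : ℝ) (ht : 0 ≤ t) :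
    F 0 t = 0 := by
  have e0 : 0 < Real.exp 1 := Real.exp_pos 1
  have main : ∀ d n : ℕ, ∀ x : ℝ, 0 ≤ x →
      x ≤ ∑ i ∈ Finset.range d, 1 / (Real.exp 1 * R (n + 1 + i)) →
      ∀ j, ‖F j x‖ ≤ Real.exp (-(n : ℝ)) * (Real.exp j * M j) := by
    intro d
    induction d with
    | zero =>
      intro n x hx hx' j
      have : x = 0 := le_antisymm (by simpa using hx') hx
      rw [this, h0]
      simp only [norm_zero]
      have := hM j
      positivity
    | succ d ih =>
      intro n x hx hx' j
      set S := ∑ i ∈ Finset.range d, 1 / (Real.exp 1 * R (n + 1 + 1 + i)) with hS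
      have hS0 : 0 ≤ S := Finset.sum_nonneg fun i _ => by have := hR (n + 1 + 1 + i); positivity
      have hx2 : x ≤ S + 1 / (Real.exp 1 * R (n + 1)) := by
        rw [Finset.sum_range_succ'] at hx'
        simp only [add_zero] at hx'
        convert hx' using 2
        rw [hS]
        refine Finset.sum_congr rfl fun i _ => ?_
        congr 3; omega
      have hP := ih (n + 1) (min x S) (le_min hx hS0) (min_le_right _ _)
      have st := bang_step F M R hM hR hRm hMR hder hb (n + 1) (Real.exp (-((n + 1 : ℕ) : ℝ))) le_rfl
        (min x S) hP x (min_le_left _ _) j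
      refine st.trans ?_
      have hh : x - min x S ≤ 1 / (Real.exp 1 * R (n + 1)) := by
        have := hR (n + 1)
        rcases le_total x S with h | h
        · rw [min_eq_left h, sub_self]; positivity
        · rw [min_eq_right h]; linarith
      have hle : Real.exp 1 * R (n + 1) * (x - min x S) ≤ 1 := by
        have hp : 0 < Real.exp 1 * R (n + 1) := mul_pos e0 (hR _)
        calc _ ≤ Real.exp 1 * R (n + 1) * (1 / (Real.exp 1 * R (n + 1))) := by gcongr
          _ = 1 := mul_one_div_cancel hp.ne'
      have hM' := hM j
      refine mul_le_mul_of_nonneg_right ?_ (by positivity)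
      rw [← Real.exp_add]
      apply Real.exp_le_exp.2
      push_cast
      linarith
  have hall : ∀ n : ℕ, ‖F 0 t‖ ≤ Real.exp (-(n : ℝ)) * M 0 := by
    intro n
    have hns : ¬ Summable (fun i => 1 / (Real.exp 1 * R (n + 1 + i))) := by
      intro hs
      apply hdiv
      rw [← summable_nat_add_iff (n + 1)]
      refine (hs.mul_left (Real.exp 1)).congr fun i => ?_
      have := hR (n + 1 + i)
      rw [add_comm i]
      field_simp
    have htd := (not_summable_iff_tendsto_nat_atTop_of_nonneg
      (fun i => by have := hR (n + 1 + i); positivity)).1 hns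
    obtain ⟨d, hd⟩ := (htd.eventually (eventually_ge_atTop t)).exists
    simpa using main d n t ht hd 0
  have hlim : Tendsto (fun n : ℕ => Real.exp (-(n : ℝ)) * M 0) atTop (nhds (0 * M 0)) :=
    (Real.tendsto_exp_neg_atTop_nhds_zero.comp tendsto_natCast_atTop_atTop).mul_const _
  have := ge_of_tendsto' hlim hall
  simpa using this

/-- Derivatives of the characteristic function. -/
noncomputable def cfd (μ : Measure ℝ) (j : ℕ) (t : ℝ) : ℂ :=
  ∫ x : ℝ, ((x : ℂ) * Complex.I) ^ j * Complex.exp (t * x * Complex.I) ∂μ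

lemma cfd_norm (j : ℕ) (t x : ℝ) :
    ‖((x : ℂ) * Complex.I) ^ j * Complex.exp (t * x * Complex.I)‖ = |x| ^ j := by
  have : Complex.exp (t * x * Complex.I) = Complex.exp (((t * x : ℝ) : ℂ) * Complex.I) := by
    push_cast; rfl
  rw [norm_mul, this, Complex.norm_exp_ofReal_mul_I]
  simp

lemma cfd_integrable (μ : Measure ℝ) (j : ℕ) (t : ℝ) (h : Integrable (fun x : ℝ => x ^ j) μ) :
    Integrable (fun x : ℝ => ((x : ℂ) * Complex.I) ^ j * Complex.exp (t * x * Complex.I)) μ := by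
  refine h.mono (Continuous.aestronglyMeasurable (by fun_prop)) (ae_of_all _ fun x => ?_)
  rw [cfd_norm]; simp

lemma cfd_hasDerivAt (μ : Measure ℝ) (h : ∀ j, Integrable (fun x : ℝ => x ^ j) μ) (j : ℕ) (t : ℝ) :
    HasDerivAt (cfd μ j) (cfd μ (j + 1) t) t := by
  refine (hasDerivAt_integral_of_dominated_loc_of_deriv_le (μ := μ) (s := univ)
    (bound := fun x => |x| ^ (j + 1))
    (F := fun (t : ℝ) (x : ℝ) => ((x : ℂ) * Complex.I) ^ j * Complex.exp (t * x * Complex.I))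
    (F' := fun (t : ℝ) (x : ℝ) =>
      ((x : ℂ) * Complex.I) ^ (j + 1) * Complex.exp (t * x * Complex.I))
    univ_mem ?_ (cfd_integrable μ j t (h j)) ?_ ?_ ?_ ?_).2
  · exact Eventually.of_forall fun s => (cfd_integrable μ j s (h j)).aestronglyMeasurable
  · exact (cfd_integrable μ (j + 1) t (h (j + 1))).aestronglyMeasurable
  · exact ae_of_all _ fun x s _ => (cfd_norm (j + 1) s x).le
  · simpa [abs_pow] using (h (j + 1)).abs
  · refine ae_of_all _ fun x s _ => ?_
    have h1 : HasDerivAt (fun s : ℝ => (s : ℂ) * x * Complex.I) (1 * x * Complex.I) s :=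
      ((Complex.ofRealCLM.hasDerivAt (x := s)).mul_const (x : ℂ)).mul_const Complex.I
    have h2 := (h1.cexp).const_mul (((x : ℂ) * Complex.I) ^ j)
    refine h2.congr_deriv ?_
    rw [one_mul, pow_succ]
    ring

lemma determinate (μ ν : Measure ℝ) [IsFiniteMeasure μ] [IsFiniteMeasure ν]
    (m R : ℕ → ℝ)
    (hμ : ∀ j, Integrable (fun x : ℝ => x ^ j) μ) (hν : ∀ j, Integrable (fun x : ℝ => x ^ j) ν)
    (hμ0 : ∀ᵐ x ∂μ, 0 ≤ x) (hν0 : ∀ᵐ x ∂ν, 0 ≤ x)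
    (hμm : ∀ j, ∫ x, x ^ j ∂μ = m j) (hνm : ∀ j, ∫ x, x ^ j ∂ν = m j)
    (hm : ∀ j, 0 < m j) (hR : ∀ j, 0 < R j)
    (hRm : Monotone R) (hmR : ∀ j, m (j + 1) ≤ R (j + 1) * m j)
    (hdiv : ¬ Summable (fun k => 1 / R k)) : μ = ν := by
  have bd : ∀ (ρ : Measure ℝ), (∀ᵐ x ∂ρ, 0 ≤ x) → ∀ j t, ‖cfd ρ j t‖ ≤ ∫ x, x ^ j ∂ρ := by
    intro ρ hρ j t
    refine (norm_integral_le_integral_norm _).trans (le_of_eq ?_)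
    refine integral_congr_ae ?_
    filter_upwards [hρ] with x hx
    rw [cfd_norm, abs_of_nonneg hx]
  have z : ∀ (ρ : Measure ℝ) j, cfd ρ j 0 = ((∫ x, x ^ j ∂ρ : ℝ) : ℂ) * Complex.I ^ j := by
    intro ρ j
    rw [cfd, ← integral_complex_ofReal, ← integral_mul_const]
    congr 1
    ext x
    simp [mul_pow]
  have nonneg : ∀ t : ℝ, 0 ≤ t → charFun μ t = charFun ν t := by
    intro t ht
    have := bang (fun j t => cfd μ j t - cfd ν j t) (fun j => 2 * m j) R
      (fun j => by have := hm j; positivity) hR hRm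
      (fun j => by have := hmR j; nlinarith)
      (fun j t => (cfd_hasDerivAt μ hμ j t).sub (cfd_hasDerivAt ν hν j t))
      (fun j t => by
        refine (norm_sub_le _ _).trans ?_
        have h1 := bd μ hμ0 j t
        have h2 := bd ν hν0 j t
        rw [hμm] at h1
        rw [hνm] at h2
        linarith)
      (fun j => by simp only [z, hμm, hνm, sub_self]) hdiv t ht
    rw [charFun_apply_real, charFun_apply_real]
    have h3 := sub_eq_zero.1 this
    simpa [cfd] using h3
  apply Measure.ext_of_charFun
  ext t
  rcases le_total 0 t with h | h
  · exact nonneg t h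
  · have h1 := nonneg (-t) (by linarith)
    rw [charFun_neg, charFun_neg] at h1
    exact (starRingEnd ℂ).injective h1

lemma summable_of_count (u : ℕ → ℝ) (n0 : ℕ) (hn0 : 2 ≤ n0) (N : ℕ → ℕ)
    (hN0 : ∀ k, n0 ≤ N k)
    (hN : ∀ k n, n0 ≤ n → (N k ≤ n ↔ (k : ℝ) + 2 ≤ u n))
    (hu0 : ∀ n, n0 ≤ n → 0 ≤ u n)
    (hs : Summable (fun k => 1 / (N k : ℝ))) :
    Summable (fun n : ℕ => if n0 ≤ n then u n / (n : ℝ) ^ 2 else 0) := by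
  classical
  have hsq : Summable (fun n : ℕ => 3 / (n : ℝ) ^ 2) := by
    simpa [div_eq_mul_inv] using (Real.summable_nat_pow_inv.2 (by norm_num : 1 < 2)).mul_left (3 : ℝ)
  refine summable_of_sum_range_le
    (c := ∑' n : ℕ, 3 / (n : ℝ) ^ 2 + 2 * ∑' k, 1 / (N k : ℝ)) ?_ ?_
  · intro n
    split_ifs with h
    · exact div_nonneg (hu0 n h) (by positivity)
    · exact le_rfl
  intro L
  obtain ⟨K, hK⟩ : ∃ K : ℕ, ∀ n ∈ Finset.range L, u n ≤ K := by
    refine ⟨(Finset.range L).sup fun n => ⌈u n⌉₊, fun n hn => ?_⟩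
    exact (Nat.le_ceil _).trans (Nat.cast_le.2 (Finset.le_sup (f := fun n => ⌈u n⌉₊) hn))
  have cnt : ∀ n ∈ Finset.range L, (if n0 ≤ n then u n / (n : ℝ) ^ 2 else 0) ≤
      3 / (n : ℝ) ^ 2 + ∑ k ∈ Finset.range K, if N k ≤ n then ((n : ℝ) ^ 2)⁻¹ else 0 := by
    intro n hn
    have hnn : 0 ≤ ∑ k ∈ Finset.range K, if N k ≤ n then ((n : ℝ) ^ 2)⁻¹ else 0 :=
      Finset.sum_nonneg fun k _ => by split_ifs <;> positivity
    split_ifs with h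
    · rw [← Finset.sum_filter, Finset.sum_const, nsmul_eq_mul]
      have hsub : Finset.range (⌊u n⌋₊ - 1) ⊆ (Finset.range K).filter (fun k => N k ≤ n) := by
        intro k hk
        rw [Finset.mem_range] at hk
        have h1 : k + 2 ≤ ⌊u n⌋₊ := by omega
        have h2 : ((k + 2 : ℕ) : ℝ) ≤ u n := (Nat.cast_le.2 h1).trans (Nat.floor_le (hu0 n h))
        push_cast at h2
        rw [Finset.mem_filter, Finset.mem_range, hN k n h]
        refine ⟨?_, h2⟩
        have h3 := hK n hn
        have : (k : ℝ) < K := by linarith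
        exact_mod_cast this
      have hc := Finset.card_le_card hsub
      rw [Finset.card_range] at hc
      have hc' : ⌊u n⌋₊ ≤ ((Finset.range K).filter (fun k => N k ≤ n)).card + 1 := by omega
      have hc2 : (⌊u n⌋₊ : ℝ) ≤ ((Finset.range K).filter (fun k => N k ≤ n)).card + 1 := by
        exact_mod_cast hc'
      have hlt := Nat.lt_floor_add_one (u n)
      rw [← div_eq_mul_inv, ← add_div]
      apply div_le_div_of_nonneg_right _ (by positivity)
      linarith
    · positivity
  have swap : ∀ k, ∑ n ∈ Finset.range L, (if N k ≤ n then ((n : ℝ) ^ 2)⁻¹ else 0) ≤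
      2 * (1 / (N k : ℝ)) := by
    intro k
    have hNk := hN0 k
    rw [← Finset.sum_filter]
    have heq : (Finset.range L).filter (fun n => N k ≤ n) = Finset.Ioo (N k - 1) L := by
      ext n
      simp only [Finset.mem_filter, Finset.mem_range, Finset.mem_Ioo]
      omega
    rw [heq]
    refine (sum_Ioo_inv_sq_le _ _).trans (le_of_eq ?_)
    rw [Nat.cast_sub (by omega)]
    push_cast
    rw [sub_add_cancel]; ring
  calc _ ≤ ∑ n ∈ Finset.range L, (3 / (n : ℝ) ^ 2 +
        ∑ k ∈ Finset.range K, if N k ≤ n then ((n : ℝ) ^ 2)⁻¹ else 0) := Finset.sum_le_sum cnt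
    _ = ∑ n ∈ Finset.range L, 3 / (n : ℝ) ^ 2 + ∑ k ∈ Finset.range K, ∑ n ∈ Finset.range L,
        (if N k ≤ n then ((n : ℝ) ^ 2)⁻¹ else 0) := by
          rw [Finset.sum_add_distrib, Finset.sum_comm (s := Finset.range L)]
    _ ≤ ∑ n ∈ Finset.range L, 3 / (n : ℝ) ^ 2 + ∑ k ∈ Finset.range K, 2 * (1 / (N k : ℝ)) := by
          gcongr with k hk
          exact swap k
    _ ≤ _ := by
          rw [← Finset.mul_sum]
          gcongr
          · exact hsq.sum_le_tsum _ fun n _ => by positivity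
          · exact hs.sum_le_tsum _ fun n _ => by positivity

/-- Theorem 4, discrete Stieltjes case: a nonnegative
integer-valued random variable whose probabilities satisfy the divergence
condition (11) and the monotone growth condition (12) satisfies the Stieltjes
Carleman condition and is moment-determinate on [0,∞). -/
theorem stmt_8 (p : ℕ → ℝ) (n0 : ℕ) (hn0 : 2 ≤ n0)
    (hpos : ∀ n : ℕ, 0 < p n)
    (htotal : HasSum p 1)
    (hmom : ∀ k : ℕ, Summable (fun n : ℕ => (n : ℝ) ^ k * p n))
    -- condition (11)
    (hK : ¬ Summable (fun n : ℕ =>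
        if n0 ≤ n then -Real.log (p n) / ((n : ℝ) ^ 2 * Real.log (n : ℝ)) else 0))
    -- condition (12)
    (hu_mono : ∀ n n' : ℕ, n0 ≤ n → n ≤ n' →
        -Real.log (p n / 2) / Real.log (n : ℝ) ≤ -Real.log (p n' / 2) / Real.log (n' : ℝ))
    (hu_top : Tendsto (fun n : ℕ => -Real.log (p n / 2) / Real.log (n : ℝ)) atTop atTop) :
    -- Carleman's condition (Stieltjes case)
    (¬ Summable (fun k : ℕ =>
        (∑' n : ℕ, (n : ℝ) ^ (k + 1) * p n) ^ (-(1 / (2 * ((k : ℝ) + 1)))))) ∧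
    -- moment determinacy on [0,∞)
    (∀ μ : Measure ℝ, IsProbabilityMeasure μ → μ (Set.Iio 0) = 0 →
        (∀ k : ℕ, ∫ x, x ^ k ∂μ = ∑' n : ℕ, (n : ℝ) ^ k * p n) →
        μ = Measure.sum (fun n : ℕ => ENNReal.ofReal (p n) • Measure.dirac (n : ℝ))) := by
  classical
  set u : ℕ → ℝ := fun n => -Real.log (p n / 2) / Real.log (n : ℝ) with hu
  set m : ℕ → ℝ := fun k => ∑' n : ℕ, (n : ℝ) ^ k * p n with hm
  have hlogpos : ∀ n, n0 ≤ n → 0 < Real.log (n : ℝ) := by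
    intro n hn
    apply Real.log_pos
    have : 2 ≤ n := hn0.trans hn
    exact_mod_cast this
  have hp1 : ∀ n, p n ≤ 1 := fun n => le_hasSum htotal n fun i _ => (hpos i).le
  have hu0 : ∀ n, n0 ≤ n → 0 ≤ u n := by
    intro n hn
    refine div_nonneg ?_ (hlogpos n hn).le
    have := Real.log_nonpos (by have := hpos n; positivity : 0 ≤ p n / 2)
      (by have := hp1 n; linarith)
    linarith
  -- the inverse function of u
  have hex : ∀ k : ℕ, ∃ n, n0 ≤ n ∧ (k : ℝ) + 2 ≤ u n := by
    intro k
    obtain ⟨n, h1, h2⟩ := ((hu_top.eventually (eventually_ge_atTop ((k : ℝ) + 2))).and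
      (eventually_ge_atTop n0)).exists
    exact ⟨n, h2, h1⟩
  set N : ℕ → ℕ := fun k => Nat.find (hex k) with hNdef
  have hN0 : ∀ k, n0 ≤ N k := fun k => (Nat.find_spec (hex k)).1
  have hNs : ∀ k : ℕ, (k : ℝ) + 2 ≤ u (N k) := fun k => (Nat.find_spec (hex k)).2
  have hN : ∀ k n, n0 ≤ n → (N k ≤ n ↔ (k : ℝ) + 2 ≤ u n) := by
    intro k n hn
    constructor
    · intro h
      exact (hNs k).trans (hu_mono _ _ (hN0 k) h)
    · intro h
      exact Nat.find_min' (hex k) ⟨hn, h⟩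
  have hNmono : Monotone N := by
    intro k l hkl
    rw [hN k _ (hN0 l)]
    have : (k : ℝ) ≤ l := by exact_mod_cast hkl
    linarith [hNs l]
  have hNpos : ∀ k, (1 : ℝ) ≤ N k := by
    intro k
    have : 1 ≤ N k := le_trans (by omega) (hN0 k)
    exact_mod_cast this
  have hNdiv : ¬ Summable (fun k => 1 / (N k : ℝ)) := by
    intro hs
    apply hK
    refine Summable.of_nonneg_of_le ?_ ?_ (summable_of_count u n0 hn0 N hN0 hN hu0 hs)
    · intro n
      split_ifs with h
      · have h1 := hlogpos n h
        have h2 := Real.log_nonpos (hpos n).le (hp1 n)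
        exact div_nonneg (by linarith) (by positivity)
      · exact le_rfl
    · intro n
      split_ifs with h
      · have h1 := hlogpos n h
        have hnp : (0 : ℝ) < n := by
          have : 0 < n := by omega
          exact_mod_cast this
        rw [hu]
        simp only
        rw [div_div, mul_comm (Real.log (n : ℝ))]
        apply div_le_div_of_nonneg_right _ (by positivity)
        rw [Real.log_div (hpos n).ne' (by norm_num)]
        have := Real.log_nonneg (by norm_num : (1 : ℝ) ≤ 2)
        linarith
      · exact le_rfl
  -- moments
  have hmp : ∀ k, p 1 ≤ m k := by
    intro k
    have := (hmom k).le_tsum 1 (fun i _ => by have := hpos i; positivity)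
    simpa using this
  have hmpos : ∀ k, 0 < m k := fun k => (hpos 1).trans_le (hmp k)
  have hm0 : m 0 = 1 := by simpa [hm] using htotal.tsum_eq
  have hsq : Summable (fun n : ℕ => 2 / (n : ℝ) ^ 2) := by
    simpa [div_eq_mul_inv] using (Real.summable_nat_pow_inv.2 (by norm_num : 1 < 2)).mul_left (2 : ℝ)
  set D : ℝ := (∑' n : ℕ, 2 / (n : ℝ) ^ 2) / p 1 with hD
  have hD0 : 0 ≤ D := div_nonneg (tsum_nonneg fun n => by positivity) (hpos 1).le
  have hrec : ∀ k, m (k + 1) ≤ (1 + D) * N (k + 1) * m k := by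
    intro k
    have pt : ∀ n : ℕ, (n : ℝ) ^ (k + 1) * p n ≤
        N (k + 1) * ((n : ℝ) ^ k * p n) + 2 / (n : ℝ) ^ 2 := by
      intro n
      have hpn := hpos n
      rcases lt_or_ge n (N (k + 1)) with h | h
      · have h1 : (n : ℝ) ≤ N (k + 1) := by exact_mod_cast h.le
        have h2 : (n : ℝ) ^ (k + 1) * p n ≤ N (k + 1) * ((n : ℝ) ^ k * p n) := by
          rw [pow_succ', mul_assoc]
          gcongr
        have h3 : 0 ≤ 2 / (n : ℝ) ^ 2 := by positivity
        linarith
      · have hn : n0 ≤ n := (hN0 _).trans h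
        have hnp : (0 : ℝ) < n := by
          have : 0 < n := by omega
          exact_mod_cast this
        have h1 := (hN (k + 1) n hn).1 h
        have hl := hlogpos n hn
        rw [hu] at h1
        simp only at h1
        rw [le_div_iff₀ hl] at h1
        have h2 : Real.log (p n / 2) ≤ Real.log (((n : ℝ) ^ (k + 3))⁻¹) := by
          rw [Real.log_inv, Real.log_pow]
          push_cast at h1 ⊢
          linarith
        have h3 := (Real.log_le_log_iff (by positivity) (by positivity)).1 h2
        have h4 : (n : ℝ) ^ (k + 1) * p n ≤ 2 / (n : ℝ) ^ 2 := by
          calc (n : ℝ) ^ (k + 1) * p n = (n : ℝ) ^ (k + 1) * 2 * (p n / 2) := by ring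
            _ ≤ (n : ℝ) ^ (k + 1) * 2 * ((n : ℝ) ^ (k + 3))⁻¹ := by gcongr
            _ = 2 / (n : ℝ) ^ 2 := by
              rw [show k + 3 = (k + 1) + 2 by ring, pow_add (n : ℝ) (k + 1) 2]
              field_simp
        have h5 : 0 ≤ (N (k + 1) : ℝ) * ((n : ℝ) ^ k * p n) := by positivity
        linarith
    have h1 : m (k + 1) ≤ N (k + 1) * m k + ∑' n : ℕ, 2 / (n : ℝ) ^ 2 := by
      have h2 := (hmom (k + 1)).tsum_le_tsum pt (((hmom k).mul_left _).add hsq)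
      rwa [((hmom k).mul_left _).tsum_add hsq, tsum_mul_left] at h2
    have h2 : ∑' n : ℕ, 2 / (n : ℝ) ^ 2 = D * p 1 := by
      rw [hD, div_mul_cancel₀ _ (hpos 1).ne']
    have h3 : D * p 1 ≤ D * N (k + 1) * m k := by
      have := hmp k
      have h4 := hNpos (k + 1)
      have h5 := hmpos k
      have h6 := hpos 1
      calc D * p 1 ≤ D * m k := by gcongr
        _ = D * 1 * m k := by ring
        _ ≤ D * N (k + 1) * m k := by gcongr
    nlinarith
  set R : ℕ → ℝ := fun k => (1 + D) * N k with hRdef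
  have hR1 : ∀ k, 1 ≤ R k := fun k =>
    one_le_mul_of_one_le_of_one_le (by linarith) (hNpos k)
  have hRpos : ∀ k, 0 < R k := fun k => one_pos.trans_le (hR1 k)
  have hRmono : Monotone R := by
    intro k l hkl
    have : (N k : ℝ) ≤ N l := by exact_mod_cast hNmono hkl
    simp only [hRdef]
    gcongr
  have hRdiv : ¬ Summable (fun k => 1 / R k) := by
    intro hs
    apply hNdiv
    refine (hs.mul_left (1 + D)).congr fun k => ?_
    have := hNpos k
    simp only [hRdef]
    field_simp
  have hmR : ∀ k, m k ≤ R k ^ k := by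
    intro k
    induction k with
    | zero => simp [hm0]
    | succ k ih =>
      calc m (k + 1) ≤ R (k + 1) * m k := hrec k
        _ ≤ R (k + 1) * R (k + 1) ^ k := by
          have h1 := hRpos k
          have h2 := hRpos (k + 1)
          have h3 := hRmono (Nat.le_succ k)
          gcongr
          exact ih.trans (by gcongr)
        _ = R (k + 1) ^ (k + 1) := by ring
  refine ⟨?_, ?_⟩
  · intro hs
    apply hRdiv
    rw [← summable_nat_add_iff 1]
    refine Summable.of_nonneg_of_le (fun k => by have := hRpos (k + 1); positivity) ?_ hs
    intro k
    change 1 / R (k + 1) ≤ (m (k + 1)) ^ (-(1 / (2 * ((k : ℝ) + 1))))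
    have h1 := hR1 (k + 1)
    have h0 := hRpos (k + 1)
    have hk : (0 : ℝ) < (k : ℝ) + 1 := by positivity
    calc 1 / R (k + 1) = R (k + 1) ^ (-1 : ℝ) := by rw [Real.rpow_neg_one, one_div]
      _ ≤ R (k + 1) ^ (-(1 / 2) : ℝ) := Real.rpow_le_rpow_of_exponent_le h1 (by norm_num)
      _ = (R (k + 1) ^ (k + 1)) ^ (-(1 / (2 * ((k : ℝ) + 1)))) := by
        rw [← Real.rpow_natCast, ← Real.rpow_mul h0.le]
        congr 1
        push_cast
        field_simp
      _ ≤ _ := by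
        apply Real.rpow_le_rpow_of_nonpos (hmpos _) (hmR _)
        have : 0 ≤ 1 / (2 * ((k : ℝ) + 1)) := by positivity
        linarith
  · intro μ hμ hμ0 hμm
    set ν : Measure ℝ := Measure.sum (fun n : ℕ => ENNReal.ofReal (p n) • Measure.dirac (n : ℝ))
      with hν
    have hνint : ∀ j : ℕ, Integrable (fun x : ℝ => x ^ j) ν := by
      intro j
      refine integrable_sum_dirac (fun i => ENNReal.ofReal_ne_top) ?_
      refine (hmom j).congr fun n => ?_
      rw [ENNReal.toReal_ofReal (hpos n).le]
      simp [mul_comm]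
    have hνm : ∀ j : ℕ, ∫ x, x ^ j ∂ν = m j := by
      intro j
      rw [hν, integral_sum_measure (hνint j)]
      refine tsum_congr fun n => ?_
      rw [integral_smul_measure, integral_dirac, ENNReal.toReal_ofReal (hpos n).le, smul_eq_mul,
        mul_comm]
    have hνfin : IsFiniteMeasure ν := by
      have h := hνint 0
      simp only [pow_zero] at h
      exact (integrable_const_iff_isFiniteMeasure one_ne_zero).1 h
    have hν0 : ∀ᵐ x ∂ν, 0 ≤ x := by
      rw [hν, Measure.ae_sum_iff]
      intro n
      refine Measure.ae_smul_measure ?_ _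
      rw [ae_dirac_eq]
      exact (Nat.cast_nonneg n : (0 : ℝ) ≤ (n : ℝ))
    have hμint : ∀ j : ℕ, Integrable (fun x : ℝ => x ^ j) μ := by
      intro j
      by_contra hcon
      have := hμm j
      rw [integral_undef hcon] at this
      exact (hmpos j).ne this
    have hμ0' : ∀ᵐ x ∂μ, 0 ≤ x := by
      rw [ae_iff]
      simpa [Set.Iio] using hμ0
    exact determinate μ ν m R hμint hνint hμ0' hν0 hμm hνm hmpos hRpos hRmono hrec hRdiv
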